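/- Let p be an odd prime and let n be an even non-negative integer. There is no free continuous action of the cyclic group ℤ/p on the sphere S^n. -/

import Mathlib

open Set MeasureTheory Function
open scoped ContDiff

/-- Stokes theorem on a box for a closed form vanishing on the lateral faces. -/
theorem setIntegral_eq_of_extDeriv_eq_zero {m : ℕ} {a b : Fin (m + 1) → ℝ} (hab : a ≤ b)
    {η : (Fin (m + 1) → ℝ) → (Fin (m + 1) → ℝ) [⋀^Fin m]→L[ℝ] ℝ}
    (hη : Differentiable ℝ η) (hd : ∀ x, extDeriv η x = 0)
    (hlat : ∀ x ∈ Icc a b, ∀ i : Fin m, (x i.succ = a i.succ ∨ x i.succ = b i.succ) → η x = 0) :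
    ∫ x in Icc (Fin.tail a) (Fin.tail b), η (Fin.cons (a 0) x) (fun j ↦ Pi.single j.succ 1) =
      ∫ x in Icc (Fin.tail a) (Fin.tail b),
        η (Fin.cons (b 0) x) (fun j ↦ Pi.single j.succ 1) := by
  let e : Fin (m + 1) → Fin (m + 1) → ℝ := fun i ↦ Pi.single i 1
  let f : Fin (m + 1) → (Fin (m + 1) → ℝ) → ℝ := fun i x ↦ (-1) ^ i.val • η x (Fin.removeNth i e)
  have hf0 : ∀ i, Differentiable ℝ fun x ↦ η x (Fin.removeNth i e) := fun i x ↦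
    (((ContinuousAlternatingMap.apply ℝ _ ℝ (Fin.removeNth i e))).differentiableAt.comp x (hη x) :)
  have hf : ∀ i, Differentiable ℝ (f i) := fun i ↦ (hf0 i).fun_const_smul _
  have hdiv : ∀ x, ∑ i, fderiv ℝ (f i) x (e i) = 0 := by
    intro x
    have h := extDeriv_apply (hη x) e
    rw [hd x] at h
    refine Eq.trans ?_ h.symm
    refine Finset.sum_congr rfl fun i _ ↦ ?_
    simp only [f]
    rw [fderiv_fun_const_smul (hf0 i x)]
    rfl
  have key := integral_divergence_of_hasFDerivAt_off_countable' a b hab f (fun i ↦ fderiv ℝ (f i)) ∅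
    countable_empty (fun i ↦ (hf i).continuous.continuousOn) (fun x _ i ↦ (hf i x).hasFDerivAt)
    (by
      have : (fun x ↦ ∑ i, fderiv ℝ (f i) x (Pi.single i 1)) = fun _ ↦ 0 := funext hdiv
      rw [this]
      exact integrableOn_zero)
  have hz : ∀ i : Fin m, ∀ c, (c = a i.succ ∨ c = b i.succ) →
      ∫ x in Icc (a ∘ i.succ.succAbove) (b ∘ i.succ.succAbove), f i.succ (i.succ.insertNth c x)
        = 0 := by
    intro i c hc
    refine setIntegral_eq_zero_of_forall_eq_zero fun x hx ↦ ?_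
    have hc' : c ∈ Icc (a i.succ) (b i.succ) := by
      rcases hc with rfl | rfl
      · exact ⟨le_rfl, hab _⟩
      · exact ⟨hab _, le_rfl⟩
    have := hlat (i.succ.insertNth c x) ?_ i (by simpa using hc)
    · simp [f, this]
    · exact (Fin.insertNth_mem_Icc).2 ⟨hc', hx⟩
  have hdiv' : ∀ x, ∑ i, fderiv ℝ (f i) x (Pi.single i 1) = 0 := hdiv
  simp only [hdiv', integral_zero] at key
  rw [Fin.sum_univ_succ, Finset.sum_eq_zero (s := Finset.univ), add_zero, eq_comm, sub_eq_zero]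
    at key
  · simpa [f, e, Fin.tail, Fin.tail_def, comp_def] using key.symm
  · intro i _
    rw [hz i _ (Or.inl rfl), hz i _ (Or.inr rfl), sub_zero]

/-- The determinant as a continuous alternating map. -/
noncomputable def detContinuousAlternating (m : ℕ) : (Fin m → ℝ) [⋀^Fin m]→L[ℝ] ℝ :=
  { (Matrix.detRowAlternating : (Fin m → ℝ) [⋀^Fin m]→ₗ[ℝ] ℝ) with
    cont := by
      change Continuous fun M : Matrix (Fin m) (Fin m) ℝ ↦ M.det
      exact continuous_id.matrix_det }

theorem detContinuousAlternating_apply {m : ℕ} (v : Fin m → Fin m → ℝ) :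
    detContinuousAlternating m v = (Matrix.of v).det := rfl

/-- Alternating forms of degree above the dimension vanish. -/
theorem ContinuousAlternatingMap.eq_zero_of_fin_succ {m : ℕ}
    (φ : (Fin m → ℝ) [⋀^Fin (m + 1)]→L[ℝ] ℝ) : φ = 0 := by
  ext v
  refine φ.map_linearDependent v fun h ↦ ?_
  simpa using h.fintype_card_le_finrank

theorem continuous_finTail (m : ℕ) :
    Continuous (Fin.tail : (Fin (m + 1) → ℝ) → Fin m → ℝ) :=
  continuous_pi fun i ↦ continuous_apply i.succ

/-- The cylinder `[0, 1] × ∂[-1, 1]^m`. -/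
def cubeCylinder (m : ℕ) : Set (Fin (m + 1) → ℝ) :=
  {v | v 0 ∈ Icc (0 : ℝ) 1 ∧ ‖Fin.tail v‖ = 1}

theorem isCompact_cubeCylinder (m : ℕ) : IsCompact (cubeCylinder m) := by
  refine Metric.isCompact_of_isClosed_isBounded ?_ ?_
  · exact (isClosed_Icc.preimage (continuous_apply 0)).inter
      (isClosed_eq (continuous_finTail m).norm continuous_const)
  · refine (Metric.isBounded_closedBall (x := 0) (r := 1)).subset fun v hv ↦ ?_
    refine mem_closedBall_zero_iff.2 ((pi_norm_le_iff_of_nonneg zero_le_one).2 fun i ↦ ?_)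
    refine Fin.cases ?_ (fun i ↦ ?_) i
    · exact abs_le.2 ⟨by linarith [hv.1.1], hv.1.2⟩
    · exact hv.2 ▸ norm_le_pi_norm (Fin.tail v) i

/-- In odd dimension, no smooth homotopy without zeros on the boundary of the cube joins the
identity to the antipodal map. -/
theorem exists_zero_of_contDiff_of_odd {m : ℕ} (hm : Odd m) {F : (Fin (m + 1) → ℝ) → Fin m → ℝ}
    (hF : ContDiff ℝ ∞ F) (h0 : ∀ x : Fin m → ℝ, F (Fin.cons 0 x) = x)
    (h1 : ∀ x : Fin m → ℝ, F (Fin.cons 1 x) = -x) :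
    ∃ v ∈ cubeCylinder m, F v = 0 := by
  by_contra! hne
  let K := cubeCylinder m
  have hKc : IsCompact K := isCompact_cubeCylinder m
  obtain ⟨δ, hδ, hδF⟩ : ∃ δ > 0, ∀ v ∈ K, δ ≤ ‖F v‖ := by
    rcases K.eq_empty_or_nonempty with h | h
    · exact ⟨1, one_pos, by simp [h]⟩
    · obtain ⟨v, hv, hmin⟩ := hKc.exists_isMinOn h hF.continuous.norm.continuousOn
      exact ⟨‖F v‖, norm_pos_iff.2 (hne v hv), fun w hw ↦ hmin hw⟩
  let ψ : ContDiffBump (0 : Fin m → ℝ) := ⟨δ / 2, δ, by positivity, by linarith⟩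
  have hψ : ContDiff ℝ ∞ ψ := ψ.contDiff
  let σ : (Fin m → ℝ) → (Fin m → ℝ) [⋀^Fin m]→L[ℝ] ℝ := fun y ↦ ψ y • detContinuousAlternating m
  have hσ : Differentiable ℝ σ := fun y ↦
    ((hψ.differentiable (by simp)) y).smul_const _
  let η : (Fin (m + 1) → ℝ) → (Fin (m + 1) → ℝ) [⋀^Fin m]→L[ℝ] ℝ :=
    fun x ↦ (σ (F x)).compContinuousLinearMap (fderiv ℝ F x)
  have hFd : Differentiable ℝ F := hF.differentiable (by simp)
  have hη : Differentiable ℝ η := fun x ↦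
    ((hσ _).comp x (hFd x)).continuousAlternatingMapCompContinuousLinearMap
      ((hF.fderiv_right (m := 1) (by norm_cast)).differentiable (by simp) x)
  have hd : ∀ x, extDeriv η x = 0 := by
    intro x
    rw [extDeriv_pullback (hσ _) hF.contDiffAt (by simp; norm_cast),
      ContinuousAlternatingMap.eq_zero_of_fin_succ (extDeriv σ (F x))]
    rfl
  have key := setIntegral_eq_of_extDeriv_eq_zero (a := Fin.cons 0 fun _ ↦ -1)
    (b := Fin.cons 1 fun _ ↦ 1) ?_ hη hd ?_
  rotate_left
  · intro i
    refine Fin.cases ?_ (fun i ↦ ?_) i <;> simp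
  · intro x hx i hi
    have hxK : x ∈ K := by
      refine ⟨by simpa using ⟨hx.1 0, hx.2 0⟩, le_antisymm ?_ ?_⟩
      · refine (pi_norm_le_iff_of_nonneg zero_le_one).2 fun j ↦ abs_le.2 ?_
        simpa using ⟨hx.1 j.succ, hx.2 j.succ⟩
      · have : ‖Fin.tail x i‖ = 1 := by
          rcases hi with hi | hi <;> simp [Fin.tail, hi]
        exact this ▸ norm_le_pi_norm (Fin.tail x) i
    have : ψ (F x) = 0 := ψ.zero_of_le_dist (by simpa using hδF x hxK)
    ext v
    simp [η, σ, this]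
  have hder : ∀ (t c : ℝ), (∀ x : Fin m → ℝ, F (Fin.cons t x) = c • x) → ∀ x (j : Fin m),
      fderiv ℝ F (Fin.cons t x) (Pi.single j.succ 1) = c • Pi.single j 1 := by
    intro t c h x j
    have hF' := (hFd (Fin.cons t x)).hasFDerivAt.hasLineDerivAt (Pi.single j.succ 1)
    have hline : (fun s : ℝ ↦ F (Fin.cons t x + s • Pi.single j.succ 1)) =
        fun s ↦ c • (x + s • Pi.single j 1) := by
      funext s
      rw [← h]
      congr 1
      ext i
      refine Fin.cases ?_ (fun i ↦ ?_) i <;> simp [Pi.single_apply]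
    rw [HasLineDerivAt, hline] at hF'
    refine hF'.unique ?_
    simpa only [one_smul, id] using (((hasDerivAt_id (0 : ℝ)).smul_const
      (Pi.single j 1 : Fin m → ℝ)).const_add x).fun_const_smul c
  have hval : ∀ (t c : ℝ), (∀ x : Fin m → ℝ, F (Fin.cons t x) = c • x) → ∀ x,
      η (Fin.cons t x) (fun j ↦ Pi.single j.succ 1) = ψ (c • x) * c ^ m := by
    intro t c h x
    have : (Matrix.of fun j : Fin m ↦ c • (Pi.single j 1 : Fin m → ℝ)) = c • 1 := by
      ext i j
      simp [Matrix.one_apply, Pi.single_apply, eq_comm]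
    simp only [η, σ, ContinuousAlternatingMap.compContinuousLinearMap_apply, Function.comp_def,
      hder t c h, h x, ContinuousAlternatingMap.smul_apply, detContinuousAlternating_apply]
    rw [this]
    simp
  simp only [Fin.cons_zero, Fin.tail_cons, hval 0 1 (by simpa using h0),
    hval 1 (-1) (by simpa using h1), hm.neg_one_pow] at key
  simp only [one_smul, one_pow, mul_one, neg_smul, ψ.neg, mul_neg, integral_neg] at key
  have hpos : 0 < ∫ x in Icc (fun _ ↦ -1 : Fin m → ℝ) (fun _ ↦ 1), ψ x := by
    rw [setIntegral_pos_iff_support_of_nonneg_ae (.of_forall fun x ↦ ψ.nonneg)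
      (ψ.continuous.continuousOn.integrableOn_compact isCompact_Icc), ψ.support_eq]
    refine (Metric.measure_ball_pos volume (0 : Fin m → ℝ) (lt_min hδ one_pos)).trans_le
      (measure_mono fun x hx ↦ ?_)
    rw [mem_ball_zero_iff, lt_min_iff] at hx
    refine ⟨mem_ball_zero_iff.2 hx.1, ?_⟩
    have := fun i ↦ abs_le.1 ((norm_le_pi_norm x i).trans hx.2.le)
    exact ⟨fun i ↦ (this i).1, fun i ↦ (this i).2⟩
  linarith

/-- Stone-Weierstrass approximation by smooth functions on a compact set. -/
theorem exists_contDiff_norm_sub_lt {V ι : Type*} [NormedAddCommGroup V] [NormedSpace ℝ V]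
    [Fintype ι] {K : Set V} (hK : IsCompact K) (G : C(K, ι → ℝ)) {ε : ℝ} (hε : 0 < ε) :
    ∃ P : V → ι → ℝ, ContDiff ℝ ∞ P ∧ ∀ v : K, ‖P v - G v‖ < ε := by
  have : CompactSpace K := isCompact_iff_compactSpace.1 hK
  let A : Subalgebra ℝ C(K, ℝ) :=
    { carrier := {f | ∃ g : V → ℝ, ContDiff ℝ ∞ g ∧ ∀ v : K, f v = g v}
      mul_mem' := by
        rintro _ _ ⟨g, hg, hg'⟩ ⟨h, hh, hh'⟩
        exact ⟨g * h, hg.mul hh, fun v ↦ by simp [hg', hh']⟩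
      add_mem' := by
        rintro _ _ ⟨g, hg, hg'⟩ ⟨h, hh, hh'⟩
        exact ⟨g + h, hg.add hh, fun v ↦ by simp [hg', hh']⟩
      algebraMap_mem' := fun r ↦ ⟨fun _ ↦ r, contDiff_const, fun _ ↦ rfl⟩ }
  have hA : A.SeparatesPoints := by
    intro x y hxy
    obtain ⟨l, hl⟩ := SeparatingDual.exists_separating_of_ne (R := ℝ) (Subtype.coe_ne_coe.2 hxy)
    exact ⟨fun v : K ↦ l v, ⟨⟨fun v : K ↦ l v, by fun_prop⟩, ⟨l, l.contDiff, fun _ ↦ rfl⟩, rfl⟩, hl⟩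
  have happrox (i : ι) : ∃ g : V → ℝ, ContDiff ℝ ∞ g ∧ ∀ v : K, ‖g v - G v i‖ < ε := by
    obtain ⟨⟨f, g, hg, hfg⟩, hf⟩ :=
      ContinuousMap.exists_mem_subalgebra_near_continuousMap_of_separatesPoints A hA
        ⟨fun v ↦ G v i, by fun_prop⟩ ε hε
    refine ⟨g, hg, fun v ↦ ?_⟩
    simpa [hfg] using (ContinuousMap.norm_coe_le_norm _ v).trans_lt hf
  choose g hg hgG using happrox
  exact ⟨fun v i ↦ g i v, contDiff_pi.2 hg, fun v ↦ (pi_norm_lt_iff hε).2 fun i ↦ hgG i v⟩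

/-- In odd dimension, no homotopy without zeros on the boundary of the cube joins the identity to
the antipodal map. -/
theorem exists_zero_of_continuous_of_odd {m : ℕ} (hm : Odd m)
    (G : C(cubeCylinder m, Fin m → ℝ)) (h0 : ∀ v, v.1 0 = 0 → G v = Fin.tail v.1)
    (h1 : ∀ v, v.1 0 = 1 → G v = -Fin.tail v.1) : ∃ v, G v = 0 := by
  by_contra! hne
  have hK := isCompact_cubeCylinder m
  have : CompactSpace (cubeCylinder m) := isCompact_iff_compactSpace.1 hK
  obtain ⟨δ, hδ, hδG⟩ : ∃ δ > 0, ∀ v, δ ≤ ‖G v‖ := by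
    rcases isEmpty_or_nonempty (cubeCylinder m) with h | h
    · exact ⟨1, one_pos, fun v ↦ h.elim v⟩
    · obtain ⟨v, -, hv⟩ := isCompact_univ.exists_isMinOn univ_nonempty
        (G.continuous.norm.continuousOn (s := univ))
      exact ⟨‖G v‖, norm_pos_iff.2 (hne v), fun w ↦ hv (mem_univ w)⟩
  obtain ⟨P, hP, hPG⟩ := exists_contDiff_norm_sub_lt hK G (half_pos hδ)
  have htail : ContDiff ℝ ∞ (Fin.tail : (Fin (m + 1) → ℝ) → Fin m → ℝ) :=
    contDiff_pi.2 fun i ↦ contDiff_apply ℝ ℝ i.succ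
  have hcons (t : ℝ) : ContDiff ℝ ∞ (fun x : Fin m → ℝ ↦ (Fin.cons t x : Fin (m + 1) → ℝ)) :=
    contDiff_pi.2 fun i ↦ Fin.cases contDiff_const (fun i ↦ contDiff_apply ℝ ℝ i) i
  let F : (Fin (m + 1) → ℝ) → Fin m → ℝ := fun v ↦
    P v + ((1 - v 0) • (Fin.tail v - P (Fin.cons 0 (Fin.tail v))) +
      v 0 • (-Fin.tail v - P (Fin.cons 1 (Fin.tail v))))
  have hv0 : ContDiff ℝ ∞ fun v : Fin (m + 1) → ℝ ↦ v 0 := contDiff_apply ℝ ℝ 0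
  have hF : ContDiff ℝ ∞ F :=
    hP.add (((contDiff_const.sub hv0).smul (htail.sub (hP.comp ((hcons 0).comp htail)))).add
      (hv0.smul (htail.neg.sub (hP.comp ((hcons 1).comp htail)))))
  obtain ⟨v, hv, hFv⟩ := exists_zero_of_contDiff_of_odd hm hF (by simp [F]) (by simp [F])
  have e0 : ‖Fin.tail v - P (Fin.cons 0 (Fin.tail v))‖ < δ / 2 := by
    have hmem : (Fin.cons 0 (Fin.tail v) : Fin (m + 1) → ℝ) ∈ cubeCylinder m :=
      ⟨by simp, by simpa using hv.2⟩
    simpa [h0 ⟨_, hmem⟩, norm_sub_rev] using hPG ⟨_, hmem⟩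
  have e1 : ‖-Fin.tail v - P (Fin.cons 1 (Fin.tail v))‖ < δ / 2 := by
    have hmem : (Fin.cons 1 (Fin.tail v) : Fin (m + 1) → ℝ) ∈ cubeCylinder m :=
      ⟨by simp, by simpa using hv.2⟩
    have := hPG ⟨_, hmem⟩
    rwa [h1 ⟨_, hmem⟩ (by simp), norm_sub_rev, Fin.tail_cons] at this
  have e2 : ‖(1 - v 0) • (Fin.tail v - P (Fin.cons 0 (Fin.tail v))) +
      v 0 • (-Fin.tail v - P (Fin.cons 1 (Fin.tail v)))‖ < δ / 2 := by
    have := (convex_ball (0 : Fin m → ℝ) (δ / 2)) (mem_ball_zero_iff.2 e0) (mem_ball_zero_iff.2 e1)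
      (sub_nonneg.2 hv.1.2) hv.1.1 (by ring)
    exact mem_ball_zero_iff.1 this
  have e3 := hPG ⟨v, hv⟩
  have e4 := hδG ⟨v, hv⟩
  rw [← add_eq_zero_iff_neg_eq.1 hFv, norm_neg] at e2
  have e5 := norm_sub_norm_le (G ⟨v, hv⟩) (P v)
  rw [norm_sub_rev] at e5
  simp only at e3
  linarith

/-- On an even-dimensional sphere the antipodal map is not homotopic to the identity. -/
theorem not_homotopic_id_neg_of_odd {m : ℕ} (hm : Odd m) :
    ¬ (ContinuousMap.id (Metric.sphere (0 : EuclideanSpace ℝ (Fin m)) 1)).Homotopic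
      ⟨fun x ↦ -x, continuous_neg⟩ := by
  rintro ⟨H⟩
  have hne (v : cubeCylinder m) : (WithLp.toLp 2 (Fin.tail v.1) : EuclideanSpace ℝ (Fin m)) ≠ 0 := by
    intro h
    have h' : Fin.tail v.1 = 0 := by simpa using h
    simpa [h'] using v.2.2
  have hcont : Continuous fun v : cubeCylinder m ↦
      (WithLp.toLp 2 (Fin.tail v.1) : EuclideanSpace ℝ (Fin m)) :=
    (PiLp.continuous_toLp 2 _).comp ((continuous_finTail m).comp continuous_subtype_val)
  let N : C(cubeCylinder m, Metric.sphere (0 : EuclideanSpace ℝ (Fin m)) 1) :=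
    ⟨fun v ↦ ⟨‖(WithLp.toLp 2 (Fin.tail v.1) : EuclideanSpace ℝ (Fin m))‖⁻¹ •
      WithLp.toLp 2 (Fin.tail v.1), by simp [norm_smul, hne v]⟩,
      continuous_induced_rng.2 <|
        (hcont.norm.inv₀ fun v ↦ norm_ne_zero_iff.2 (hne v)).smul hcont⟩
  let T : C(cubeCylinder m, unitInterval) :=
    ⟨fun v ↦ ⟨v.1 0, v.2.1⟩, ((continuous_apply 0).comp continuous_subtype_val).subtype_mk _⟩
  let G : C(cubeCylinder m, Fin m → ℝ) :=
    ⟨fun v ↦ ‖(WithLp.toLp 2 (Fin.tail v.1) : EuclideanSpace ℝ (Fin m))‖ •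
      WithLp.ofLp (H (T v, N v)).1,
      hcont.norm.smul ((PiLp.continuous_ofLp 2 _).comp (continuous_subtype_val.comp
        (H.continuous.comp (T.continuous.prodMk N.continuous))))⟩
  obtain ⟨v, hv⟩ := exists_zero_of_continuous_of_odd hm G
    (fun v hv ↦ by
      have : T v = 0 := Subtype.ext hv
      simp [G, this, N, smul_smul, hne v])
    (fun v hv ↦ by
      have : T v = 1 := Subtype.ext hv
      simp [G, this, N, smul_smul, hne v])
  have h := (smul_eq_zero.1 hv).resolve_left (norm_ne_zero_iff.2 (hne v))
  have h1 : ‖(H (T v, N v)).1‖ = 1 := by simp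
  rw [(WithLp.ofLp_eq_zero 2).1 h, norm_zero] at h1
  exact zero_ne_one h1

/-- A continuous self-map of a sphere without fixed points is homotopic to the antipodal map. -/
theorem homotopic_neg_of_forall_ne {E : Type*} [NormedAddCommGroup E] [NormedSpace ℝ E]
    (f : C(Metric.sphere (0 : E) 1, Metric.sphere (0 : E) 1)) (hf : ∀ x, f x ≠ x) :
    f.Homotopic ⟨fun x ↦ -x, continuous_neg⟩ := by
  let g : unitInterval × Metric.sphere (0 : E) 1 → E :=
    fun p ↦ (1 - p.1 : ℝ) • (f p.2 : E) - (p.1 : ℝ) • (p.2 : E)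
  have hg : Continuous g := by fun_prop
  have hg0 : ∀ p, g p ≠ 0 := by
    rintro ⟨t, x⟩ h
    have h' : (1 - t : ℝ) • (f x : E) = (t : ℝ) • (x : E) := sub_eq_zero.1 h
    have hn := congrArg norm h'
    rw [norm_smul, norm_smul, norm_eq_of_mem_sphere, norm_eq_of_mem_sphere, mul_one, mul_one,
      Real.norm_of_nonneg (sub_nonneg.2 t.2.2), Real.norm_of_nonneg t.2.1] at hn
    have ht : (t : ℝ) ≠ 0 := by linarith
    rw [hn] at h'
    exact hf x (Subtype.ext (smul_right_injective E ht h'))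
  exact ⟨{
    toFun := fun p ↦ ⟨‖g p‖⁻¹ • g p, by simp [norm_smul, hg0 p]⟩
    continuous_toFun := continuous_induced_rng.2 <|
      (hg.norm.inv₀ fun p ↦ norm_ne_zero_iff.2 (hg0 p)).smul hg
    map_zero_left := fun x ↦ by ext; simp [g]
    map_one_left := fun x ↦ by ext; simp [g] }⟩

/-- Classical Smith theory (part of Theorem 1.1): for an odd prime `p` and an even `n ≥ 0`,
there is no free continuous action of `ℤ/p` on the sphere `S^n`. -/
theorem no_free_action_of_odd_prime_cyclic_group_on_even_sphere
    (p : ℕ) (hp : p.Prime) (hodd : Odd p) (n : ℕ) (hn : Even n) :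
    ¬ ∃ ρ : Multiplicative (ZMod p) →*
        Equiv.Perm (Metric.sphere (0 : EuclideanSpace ℝ (Fin (n + 1))) 1),
      (∀ g, Continuous (ρ g)) ∧ (∀ g x, ρ g x = x → g = 1) := by
  rintro ⟨ρ, hρ, hfree⟩
  let ζ : Multiplicative (ZMod p) := Multiplicative.ofAdd 1
  have : Fact p.Prime := ⟨hp⟩
  have hp2 : p ≠ 2 := by rintro rfl; exact absurd hodd (by decide)
  have hζ : ζ ≠ 1 := fun h ↦ one_ne_zero (α := ZMod p) (Multiplicative.ofAdd.injective h)
  have hζ2 : ζ * ζ ≠ 1 := by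
    intro h
    have h2 : (1 + 1 : ZMod p) = 0 := Multiplicative.ofAdd.injective h
    have h3 : ((2 : ℕ) : ZMod p) = 0 := by push_cast; rw [← h2]; norm_num
    exact hp2 ((Nat.prime_dvd_prime_iff_eq hp Nat.prime_two).1 ((ZMod.natCast_eq_zero_iff 2 p).1 h3))
  let f : C(Metric.sphere (0 : EuclideanSpace ℝ (Fin (n + 1))) 1,
    Metric.sphere (0 : EuclideanSpace ℝ (Fin (n + 1))) 1) := ⟨ρ ζ, hρ ζ⟩
  have h1 := homotopic_neg_of_forall_ne f fun x hx ↦ hζ (hfree ζ x hx)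
  have h2 := homotopic_neg_of_forall_ne (f.comp f) fun x hx ↦
    hζ2 (hfree (ζ * ζ) x (by rw [map_mul]; exact hx))
  have h3 := (h1.comp h1).symm.trans h2
  refine not_homotopic_id_neg_of_odd hn.add_one ?_
  convert h3 using 1
  ext x
  simp
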